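/- Let n ≥ 3 and let v₁, …, vₙ ∈ ℝ² be the vertices, in cyclic order, of a convex n-gon D in strictly convex position (no three of the vertices are collinear, and each vertex is extreme for their convex hull). Let the j-th side of D be the segment from vⱼ to v_{j+1} (indices mod n), and call a point interior to a side if it lies on that side but is not a vertex. Let A and B be finite sets of chords of D, where each chord joins two points that are interior to two different sides of D, such that: any two distinct chords of A are disjoint (as subsets of the plane), any two distinct chords of B are disjoint, and the set of all endpoints of chords of A equals the set of all endpoints of chords of B. Then either A = B, or there exist chords a₁, a₂ ∈ A and b₁, b₂ ∈ B and points p₁, p₂ on the boundary of D such that: a₁ and b₁ share the endpoint p₁, b₁ is to the right of a₁ at p₁ (det(q(b₁) − p₁, q(a₁) − p₁) > 0), and the other endpoints q(a₁) and q(b₁) are interior to different sides of D; and a₂ and b₂ share the endpoint p₂, b₂ is to the left of a₂ at p₂ (det(q(b₂) − p₂, q(a₂) − p₂) < 0), and the other endpoints q(a₂) and q(b₂) are interior to different sides of D. -/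

import Mathlib

/-- The standard determinant of two plane vectors. -/
def det2 (u v : ℝ × ℝ) : ℝ := u.1 * v.2 - u.2 * v.1

/-- The closed straight segment spanned by an unordered pair of points. -/
def chordSeg : Sym2 (ℝ × ℝ) → Set (ℝ × ℝ) :=
  Sym2.lift ⟨fun p q => segment ℝ p q, fun p q => segment_symm ℝ p q⟩

/-- `p` is interior to the `j`-th side of the polygon with vertices `v` (in
cyclic order), i.e. `p` lies on the segment from `v j` to `v (j+1)` and is not
one of its endpoints. -/
def IntSide {n : ℕ} [NeZero n] (v : Fin n → ℝ × ℝ) (j : Fin n) (p : ℝ × ℝ) : Prop :=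
  p ∈ segment ℝ (v j) (v (j + 1)) ∧ p ≠ v j ∧ p ≠ v (j + 1)

section ChordExchange

/-- counterclockwise hypothesis -/
def CCW {n : ℕ} [NeZero n] (v : Fin n → ℝ × ℝ) : Prop :=
  ∀ j k : Fin n, k ≠ j → k ≠ j + 1 → 0 < det2 (v (j + 1) - v j) (v k - v j)

theorem intSide_param {n : ℕ} [NeZero n] {v : Fin n → ℝ × ℝ} {j : Fin n} {p : ℝ × ℝ}
    (h : IntSide v j p) : ∃ t : ℝ, 0 < t ∧ t < 1 ∧
      p.1 = (1 - t) * (v j).1 + t * (v (j + 1)).1 ∧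
      p.2 = (1 - t) * (v j).2 + t * (v (j + 1)).2 := by
  obtain ⟨⟨a, b, ha, hb, hab, rfl⟩, h1, h2⟩ := h
  refine ⟨b, ?_, ?_, ?_, ?_⟩
  · rcases hb.lt_or_eq with hb | hb
    · exact hb
    · subst hb
      have : a = 1 := by linarith
      subst this
      simp at h1
  · rcases ha.lt_or_eq with ha | ha
    · linarith
    · subst ha
      have : b = 1 := by linarith
      subst this
      simp at h2
  · have : a = 1 - b := by linarith
    subst this
    simp
  · have : a = 1 - b := by linarith
    subst this
    simp

theorem fin_add_one_ne {n : ℕ} [NeZero n] (hn : 3 ≤ n) (j : Fin n) : j + 1 ≠ j := by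
  intro h
  have h1 : (1 : Fin n) = 0 := by simpa using h
  have := congrArg Fin.val h1
  rw [Fin.val_one', Nat.mod_eq_of_lt (by omega)] at this
  simp at this

theorem fin_add_two_ne {n : ℕ} [NeZero n] (hn : 3 ≤ n) (j : Fin n) : j + 1 + 1 ≠ j := by
  intro h
  rw [add_assoc] at h
  have h1 : (1 + 1 : Fin n) = 0 := by simpa using h
  have := congrArg Fin.val h1
  rw [Fin.val_add, Fin.val_one', Nat.mod_eq_of_lt (show 1 < n by omega),
    Nat.mod_eq_of_lt (show 1 + 1 < n by omega)] at this
  simp at this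

theorem left_of {n : ℕ} [NeZero n] (hn : 3 ≤ n) {v : Fin n → ℝ × ℝ} (hv : CCW v)
    {j k : Fin n} (hjk : k ≠ j) {q : ℝ × ℝ} (hq : IntSide v k q) :
    0 < det2 (v (j + 1) - v j) (q - v j) := by
  obtain ⟨t, h0, h1, hx, hy⟩ := intSide_param hq
  have key : det2 (v (j + 1) - v j) (q - v j) =
      (1 - t) * det2 (v (j + 1) - v j) (v k - v j) +
      t * det2 (v (j + 1) - v j) (v (k + 1) - v j) := by
    simp only [det2, Prod.fst_sub, Prod.snd_sub, hx, hy]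
    ring
  rw [key]
  have h1' : 0 < 1 - t := by linarith
  by_cases hk : k = j + 1
  · subst hk
    have e : det2 (v (j + 1) - v j) (v (j + 1) - v j) = 0 := by
      simp only [det2]; ring
    rw [e]
    have := hv j (j + 1 + 1) (fin_add_two_ne hn j) (fin_add_one_ne hn _)
    nlinarith [mul_pos h0 this]
  · have a := mul_pos h1' (hv j k hjk hk)
    have b : 0 ≤ det2 (v (j + 1) - v j) (v (k + 1) - v j) := by
      by_cases hk1 : k + 1 = j
      · rw [hk1]; simp [det2]
      · by_cases hk2 : k + 1 = j + 1
        · exact absurd (by simpa using hk2) hjk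
        · exact (hv j (k + 1) hk1 hk2).le
    have := mul_nonneg h0.le b
    linarith

theorem on_edge {n : ℕ} [NeZero n] {v : Fin n → ℝ × ℝ} {j : Fin n} {q : ℝ × ℝ}
    (hq : IntSide v j q) : det2 (v (j + 1) - v j) (q - v j) = 0 := by
  obtain ⟨t, h0, h1, hx, hy⟩ := intSide_param hq
  simp only [det2, Prod.fst_sub, Prod.snd_sub, hx, hy]
  ring

theorem side_unique {n : ℕ} [NeZero n] (hn : 3 ≤ n) {v : Fin n → ℝ × ℝ} (hv : CCW v)
    {j k : Fin n} {q : ℝ × ℝ} (hj : IntSide v j q) (hk : IntSide v k q) : k = j := by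
  by_contra h
  have := left_of hn hv h hk
  rw [on_edge hj] at this
  exact lt_irrefl _ this

theorem ofNat_ne {n : ℕ} [NeZero n] (j : Fin n) {a b : ℕ} (ha : a < n) (hb : b < n)
    (hab : a ≠ b) : j + Fin.ofNat n a ≠ j + Fin.ofNat n b := by
  intro h
  have h1 : Fin.ofNat n a = Fin.ofNat n b := by simpa using h
  have := congrArg Fin.val h1
  simp only [Fin.val_ofNat] at this
  rw [Nat.mod_eq_of_lt ha, Nat.mod_eq_of_lt hb] at this
  exact hab this

theorem ofNat_succ' {n : ℕ} [NeZero n] (j : Fin n) (a : ℕ) :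
    j + Fin.ofNat n (a + 1) = j + Fin.ofNat n a + 1 := by
  rw [add_assoc]
  congr 1
  apply Fin.ext
  simp [Fin.val_add]

theorem ofNat_full {n : ℕ} [NeZero n] (j : Fin n) : j + Fin.ofNat n n = j := by
  have : Fin.ofNat n n = 0 := by
    apply Fin.ext
    simp
  rw [this, add_zero]

theorem ofNat_sub {n : ℕ} [NeZero n] (j k : Fin n) : j + Fin.ofNat n (k - j).val = k := by
  have : Fin.ofNat n (k - j).val = k - j := by
    apply Fin.ext
    simp
  rw [this]
  abel

/-- vertices seen from an interior point of side `j` are in angular order -/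
theorem angular {n : ℕ} [NeZero n] (hn : 3 ≤ n) {v : Fin n → ℝ × ℝ} (hv : CCW v)
    {j : Fin n} {p : ℝ × ℝ} (hp : IntSide v j p) (a : ℕ) (ha : 1 ≤ a) (d : ℕ)
    (hb : a + 1 + d ≤ n) :
    0 ≤ det2 (v (j + Fin.ofNat n a) - p) (v (j + Fin.ofNat n (a + 1 + d)) - p) ∧
    (¬ (a = 1 ∧ a + 1 + d = n) →
      0 < det2 (v (j + Fin.ofNat n a) - p) (v (j + Fin.ofNat n (a + 1 + d)) - p)) := by
  have hstep : ∀ c : ℕ, 1 ≤ c → c < n →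
      0 < det2 (v (j + Fin.ofNat n c) - p) (v (j + Fin.ofNat n (c + 1)) - p) := by
    intro c hc hcn
    have hne : j ≠ j + Fin.ofNat n c := by
      have := ofNat_ne j (a := 0) (b := c) (by omega) hcn (by omega)
      simpa using this
    have := left_of hn hv hne hp
    rw [← ofNat_succ'] at this
    simp only [det2, Prod.fst_sub, Prod.snd_sub] at this ⊢
    linarith
  have hup : ∀ c : ℕ, 1 ≤ c → c ≤ n → 0 ≤ det2 (v (j + 1) - v j) (v (j + Fin.ofNat n c) - p) ∧
      (c ≠ 1 → c ≠ n → 0 < det2 (v (j + 1) - v j) (v (j + Fin.ofNat n c) - p)) := by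
    intro c hc hcn
    have hpe := on_edge hp
    have e : det2 (v (j + 1) - v j) (v (j + Fin.ofNat n c) - p) =
      det2 (v (j + 1) - v j) (v (j + Fin.ofNat n c) - v j) := by
      simp only [det2, Prod.fst_sub, Prod.snd_sub] at hpe ⊢
      linarith
    rw [e]
    have e1 : Fin.ofNat n 1 = 1 := by
      apply Fin.ext
      simp [Fin.val_one']
    have main : c ≠ 1 → c ≠ n → 0 < det2 (v (j + 1) - v j) (v (j + Fin.ofNat n c) - v j) := by
      intro h1 h2
      apply hv
      · have := ofNat_ne j (a := c) (b := 0) (by omega) (by omega) (by omega)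
        simpa using this
      · have := ofNat_ne j (a := c) (b := 1) (by omega) (by omega) (by omega)
        rwa [e1] at this
    refine ⟨?_, main⟩
    by_cases h1 : c = 1
    · subst h1
      rw [e1]
      simp only [det2]
      apply le_of_eq; ring
    · by_cases h2 : c = n
      · subst h2
        rw [ofNat_full]
        simp [det2]
      · exact (main h1 h2).le
  induction d with
  | zero =>
    have := hstep a ha (by omega)
    exact ⟨this.le, fun _ => this⟩
  | succ d ih =>
    have ih' := (ih (by omega)).2 (by omega)
    have hs := hstep (a + 1 + d) (by omega) (by omega)
    obtain ⟨ux, ux'⟩ := hup a ha (by omega)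
    obtain ⟨uy, uy'⟩ := hup (a + 1 + d) (by omega) (by omega)
    obtain ⟨uz, uz'⟩ := hup (a + 1 + d + 1) (by omega) (by omega)
    have hy := uy' (by omega) (by omega)
    rw [show a + 1 + (d + 1) = a + 1 + d + 1 by omega]
    generalize v (j + Fin.ofNat n a) - p = x at *
    generalize v (j + Fin.ofNat n (a + 1 + d)) - p = y at *
    generalize v (j + Fin.ofNat n (a + 1 + d + 1)) - p = z at *
    generalize v (j + 1) - v j = e at *
    have pl : det2 e y * det2 x z = det2 e x * det2 y z + det2 e z * det2 x y := by
      simp only [det2]; ring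
    constructor
    · by_contra hneg
      push Not at hneg
      have := mul_neg_of_pos_of_neg hy hneg
      have := mul_nonneg ux hs.le
      have := mul_nonneg uz ih'.le
      linarith
    · intro hne
      have hpos : 0 < det2 e x * det2 y z + det2 e z * det2 x y := by
        have h1 := mul_nonneg ux hs.le
        have h2 := mul_nonneg uz ih'.le
        by_cases ha1 : a = 1
        · have := mul_pos (uz' (by omega) (by omega)) ih'
          linarith
        · have := mul_pos (ux' ha1 (by omega)) hs
          linarith
      rw [← pl] at hpos
      exact (mul_pos_iff_of_pos_left hy).1 hpos

theorem det_pos_of_lt {n : ℕ} [NeZero n] (hn : 3 ≤ n) {v : Fin n → ℝ × ℝ} (hv : CCW v)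
    {j k l : Fin n} {p q r : ℝ × ℝ} (hp : IntSide v j p) (hq : IntSide v k q)
    (hr : IntSide v l r) (hjk : k ≠ j) (hkl : (k - j).val < (l - j).val) :
    0 < det2 (q - p) (r - p) := by
  obtain ⟨t, h0, h1, hx, hy⟩ := intSide_param hq
  obtain ⟨s, g0, g1, gx, gy⟩ := intSide_param hr
  have hk := ofNat_sub j k
  have hl := ofNat_sub j l
  have hln : (l - j).val < n := (l - j).isLt
  have hkpos : 1 ≤ (k - j).val := by
    rcases Nat.eq_zero_or_pos (k - j).val with h | h
    · exfalso
      have : k - j = 0 := Fin.ext (by simpa using h)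
      exact hjk (sub_eq_zero.1 this)
    · exact h
  generalize (k - j).val = a at *
  generalize (l - j).val = b at *
  subst hk hl
  rw [← ofNat_succ'] at hx hy gx gy
  obtain ⟨d, rfl⟩ : ∃ d, b = a + 1 + d := ⟨b - (a + 1), by omega⟩
  have k1 := (angular hn hv hp a hkpos d (by omega)).2 (by omega)
  have k2 := (angular hn hv hp a hkpos (d + 1) (by omega)).1
  have k4 := (angular hn hv hp (a + 1) (by omega) d (by omega)).1
  have k3 : 0 ≤ det2 (v (j + Fin.ofNat n (a + 1)) - p)
      (v (j + Fin.ofNat n (a + 1 + d)) - p) := by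
    rcases d with _ | d
    · apply le_of_eq
      simp only [det2, add_zero]; ring
    · have := (angular hn hv hp (a + 1) (by omega) d (by omega)).1
      rwa [show a + 1 + (d + 1) = a + 1 + 1 + d by omega]
  rw [show a + 1 + (d + 1) = a + 1 + d + 1 by omega] at k2
  rw [show a + 1 + 1 + d = a + 1 + d + 1 by omega] at k4
  have key : det2 (q - p) (r - p) =
      (1 - t) * (1 - s) * det2 (v (j + Fin.ofNat n a) - p) (v (j + Fin.ofNat n (a + 1 + d)) - p)
      + (1 - t) * s * det2 (v (j + Fin.ofNat n a) - p) (v (j + Fin.ofNat n (a + 1 + d + 1)) - p)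
      + t * (1 - s) * det2 (v (j + Fin.ofNat n (a + 1)) - p)
          (v (j + Fin.ofNat n (a + 1 + d)) - p)
      + t * s * det2 (v (j + Fin.ofNat n (a + 1)) - p)
          (v (j + Fin.ofNat n (a + 1 + d + 1)) - p) := by
    simp only [det2, Prod.fst_sub, Prod.snd_sub, hx, hy, gx, gy]
    ring
  rw [key]
  have h1' : 0 < 1 - t := by linarith
  have g1' : 0 < 1 - s := by linarith
  have := mul_pos (mul_pos h1' g1') k1
  have := mul_nonneg (mul_pos h1' g0).le k2
  have := mul_nonneg (mul_pos h0 g1').le k3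
  have := mul_nonneg (mul_pos h0 g0).le k4
  linarith

/-- linear functional measuring position along side `j` -/
def pos {n : ℕ} [NeZero n] (v : Fin n → ℝ × ℝ) (j : Fin n) (p : ℝ × ℝ) : ℝ :=
  (v (j + 1) - v j).1 * p.1 + (v (j + 1) - v j).2 * p.2

theorem pos_lt {n : ℕ} [NeZero n] {v : Fin n → ℝ × ℝ}
    {j : Fin n} {p q : ℝ × ℝ} (hp : IntSide v j p) (hq : IntSide v j q)
    (h : pos v j p < pos v j q) :
    ∃ c : ℝ, 0 < c ∧ q - p = c • (v (j + 1) - v j) := by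
  obtain ⟨t, h0, h1, hx, hy⟩ := intSide_param hp
  obtain ⟨s, g0, g1, gx, gy⟩ := intSide_param hq
  refine ⟨s - t, ?_, ?_⟩
  · have e : pos v j q - pos v j p =
      (s - t) * (((v (j + 1)).1 - (v j).1) ^ 2 + ((v (j + 1)).2 - (v j).2) ^ 2) := by
      simp only [pos, Prod.fst_sub, Prod.snd_sub, hx, hy, gx, gy]
      ring
    have : 0 < (s - t) * (((v (j + 1)).1 - (v j).1) ^ 2 + ((v (j + 1)).2 - (v j).2) ^ 2) := by
      rw [← e]; linarith
    exact pos_of_mul_pos_left this (by positivity)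
  · ext
    · simp only [Prod.fst_sub, Prod.smul_fst, smul_eq_mul, hx, gx]; ring
    · simp only [Prod.snd_sub, Prod.smul_snd, smul_eq_mul, hy, gy]; ring

theorem pos_inj {n : ℕ} [NeZero n] (hn : 3 ≤ n) {v : Fin n → ℝ × ℝ}
    (hinj : Function.Injective v)
    {j : Fin n} {p q : ℝ × ℝ} (hp : IntSide v j p) (hq : IntSide v j q)
    (h : pos v j p = pos v j q) : p = q := by
  obtain ⟨t, h0, h1, hx, hy⟩ := intSide_param hp
  obtain ⟨s, g0, g1, gx, gy⟩ := intSide_param hq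
  have e : pos v j q - pos v j p =
      (s - t) * (((v (j + 1)).1 - (v j).1) ^ 2 + ((v (j + 1)).2 - (v j).2) ^ 2) := by
    simp only [pos, Prod.fst_sub, Prod.snd_sub, hx, hy, gx, gy]
    ring
  have : (s - t) * (((v (j + 1)).1 - (v j).1) ^ 2 + ((v (j + 1)).2 - (v j).2) ^ 2) = 0 := by
    rw [← e]; linarith
  rcases mul_eq_zero.1 this with h | h
  · have : s = t := by linarith
    subst this
    ext
    · rw [hx, gx]
    · rw [hy, gy]
  · exfalso
    have a1 := sq_nonneg ((v (j + 1)).1 - (v j).1)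
    have a2 := sq_nonneg ((v (j + 1)).2 - (v j).2)
    have b1 : (v (j + 1)).1 - (v j).1 = 0 := pow_eq_zero_iff (two_ne_zero) |>.1 (by linarith)
    have b2 : (v (j + 1)).2 - (v j).2 = 0 := pow_eq_zero_iff (two_ne_zero) |>.1 (by linarith)
    have : v (j + 1) = v j := by
      ext
      · linarith
      · linarith
    exact fin_add_one_ne hn j (hinj this)

theorem cross {p₁ p₂ q₁ q₂ : ℝ × ℝ} (h1 : 0 < det2 (p₂ - p₁) (q₁ - p₁))
    (h2 : 0 < det2 (p₂ - p₁) (q₂ - p₁)) (h3 : 0 < det2 (q₂ - q₁) (p₁ - q₁))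
    (h4 : 0 < det2 (q₂ - q₁) (p₂ - q₁)) :
    (segment ℝ p₁ q₁ ∩ segment ℝ p₂ q₂).Nonempty := by
  -- diagonals of a convex quadrilateral
  set D := det2 (q₁ - p₁) (q₂ - p₂) with hD
  have e1 : D = det2 (p₂ - p₁) (q₁ - p₁) + det2 (q₂ - q₁) (p₁ - q₁) := by
    simp only [hD, det2, Prod.fst_sub, Prod.snd_sub]; ring
  have e2 : D = det2 (p₂ - p₁) (q₂ - p₁) + det2 (q₂ - q₁) (p₂ - q₁) := by
    simp only [hD, det2, Prod.fst_sub, Prod.snd_sub]; ring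
  have hDpos : 0 < D := by linarith
  refine ⟨p₁ + (det2 (p₂ - p₁) (q₂ - p₁) / D) • (q₁ - p₁), ?_, ?_⟩
  · rw [segment_eq_image']
    refine ⟨_, ⟨by positivity, ?_⟩, rfl⟩
    rw [div_le_one hDpos]; linarith
  · rw [segment_eq_image']
    refine ⟨det2 (p₂ - p₁) (q₁ - p₁) / D, ⟨by positivity, ?_⟩, ?_⟩
    · rw [div_le_one hDpos]; linarith
    · have hD0 := hDpos.ne'
      ext
      · simp only [Prod.fst_add, Prod.smul_fst, smul_eq_mul, Prod.fst_sub]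
        field_simp
        simp only [hD, det2, Prod.fst_sub, Prod.snd_sub]
        ring
      · simp only [Prod.snd_add, Prod.smul_snd, smul_eq_mul, Prod.snd_sub]
        field_simp
        simp only [hD, det2, Prod.fst_sub, Prod.snd_sub]
        ring

theorem anti {n : ℕ} [NeZero n] (hn : 3 ≤ n) {v : Fin n → ℝ × ℝ} (hv : CCW v)
    {i j : Fin n} (hij : i ≠ j) {p₁ p₂ q₁ q₂ : ℝ × ℝ}
    (hp1 : IntSide v i p₁) (hp2 : IntSide v i p₂)
    (hq1 : IntSide v j q₁) (hq2 : IntSide v j q₂)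
    (hd : segment ℝ p₁ q₁ ∩ segment ℝ p₂ q₂ = ∅)
    (h : pos v i p₁ < pos v i p₂) : pos v j q₂ ≤ pos v j q₁ := by
  by_contra hlt
  push Not at hlt
  obtain ⟨c, hc, ec⟩ := pos_lt hp1 hp2 h
  obtain ⟨d, hd', ed⟩ := pos_lt hq1 hq2 hlt
  have gen : ∀ (i j : Fin n) (_ : j ≠ i) (x y : ℝ × ℝ) (_ : IntSide v i x) (_ : IntSide v j y)
      (c : ℝ) (_ : 0 < c), 0 < det2 (c • (v (i + 1) - v i)) (y - x) := by
    intro i j hji x y hx hy c hc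
    have a := left_of hn hv hji hy
    have b := on_edge hx
    have : det2 (c • (v (i + 1) - v i)) (y - x) =
      c * (det2 (v (i + 1) - v i) (y - v i) - det2 (v (i + 1) - v i) (x - v i)) := by
      simp only [det2, Prod.fst_sub, Prod.snd_sub, Prod.smul_fst, Prod.smul_snd, smul_eq_mul]
      ring
    rw [this, b, sub_zero]
    exact mul_pos hc a
  have := cross (p₁ := p₁) (p₂ := p₂) (q₁ := q₁) (q₂ := q₂)
    (by rw [ec]; exact gen i j hij.symm _ _ hp1 hq1 c hc)
    (by rw [ec]; exact gen i j hij.symm _ _ hp1 hq2 c hc)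
    (by rw [ed]; exact gen j i hij _ _ hq1 hp1 d hd')
    (by rw [ed]; exact gen j i hij _ _ hq1 hp2 d hd')
  rw [hd] at this
  exact Set.not_nonempty_empty this

theorem sub_val_add {n : ℕ} [NeZero n] {x y : Fin n} (h : x ≠ y) :
    (x - y).val + (y - x).val = n := by
  have hx := x.isLt
  have hy := y.isLt
  have : x.val ≠ y.val := fun h' => h (Fin.ext h')
  simp only [Fin.sub_def]
  rcases lt_or_gt_of_ne this with h | h
  · rw [Nat.mod_eq_of_lt (by omega), show n - x.val + y.val = (y.val - x.val) + n by omega,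
      Nat.add_mod_right, Nat.mod_eq_of_lt (by omega)]
    omega
  · rw [Nat.mod_eq_of_lt (a := n - x.val + y.val) (by omega),
      show n - y.val + x.val = (x.val - y.val) + n by omega,
      Nat.add_mod_right, Nat.mod_eq_of_lt (by omega)]
    omega

theorem sum_half {n : ℕ} [NeZero n] {α : Type*} (P : Finset α) (s : α → Fin n) (a : α → α)
    (ha : ∀ p ∈ P, a p ∈ P) (haa : ∀ p ∈ P, a (a p) = p) (hs : ∀ p ∈ P, s (a p) ≠ s p) :
    2 * ∑ p ∈ P, (s (a p) - s p).val = n * P.card := by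
  have h1 : ∑ p ∈ P, (s (a p) - s p).val = ∑ p ∈ P, (s p - s (a p)).val := by
    refine Finset.sum_bij' (fun p _ => a p) (fun p _ => a p) ha ha haa haa ?_
    intro p hp
    rw [haa p hp]
  rw [two_mul]
  nth_rewrite 2 [h1]
  rw [← Finset.sum_add_distrib, Finset.sum_congr rfl (fun p hp => sub_val_add (hs p hp))]
  simp [mul_comm]

theorem same_sides {n : ℕ} [NeZero n] {α : Type*} (P : Finset α) (s : α → Fin n) (a b : α → α)
    (ha : ∀ p ∈ P, a p ∈ P) (haa : ∀ p ∈ P, a (a p) = p) (has : ∀ p ∈ P, s (a p) ≠ s p)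
    (hb : ∀ p ∈ P, b p ∈ P) (hbb : ∀ p ∈ P, b (b p) = p) (hbs : ∀ p ∈ P, s (b p) ≠ s p)
    (hle : ∀ p ∈ P, (s (a p) - s p).val ≤ (s (b p) - s p).val) :
    ∀ p ∈ P, s (a p) = s (b p) := by
  have h1 := sum_half P s a ha haa has
  have h2 := sum_half P s b hb hbb hbs
  have h3 := (Finset.sum_eq_sum_iff_of_le hle).1 (by omega)
  intro p hp
  have := Fin.ext (h3 p hp)
  simpa using this

theorem partner {n : ℕ} [NeZero n] {v : Fin n → ℝ × ℝ} {A : Finset (Sym2 (ℝ × ℝ))}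
    (hA : ∀ c ∈ A, ∃ p q : ℝ × ℝ, ∃ j k : Fin n, j ≠ k ∧
      IntSide v j p ∧ IntSide v k q ∧ p ≠ q ∧ c = s(p, q))
    (hAdisj : ∀ c ∈ A, ∀ c' ∈ A, c ≠ c' → chordSeg c ∩ chordSeg c' = ∅) :
    ∃ f : ℝ × ℝ → ℝ × ℝ, (∀ p, (∃ c ∈ A, p ∈ c) →
      s(p, f p) ∈ A ∧ f (f p) = p ∧
      ∃ j k : Fin n, j ≠ k ∧ IntSide v j p ∧ IntSide v k (f p)) ∧
      ∀ p q, s(p, q) ∈ A → q = f p := by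
  classical
  have uniq : ∀ p q q' : ℝ × ℝ, s(p, q) ∈ A → s(p, q') ∈ A → q = q' := by
    intro p q q' h h'
    by_contra hne
    have hd := hAdisj _ h _ h' (by
      intro e
      exact hne (Sym2.congr_right.1 e))
    have : p ∈ chordSeg s(p, q) ∩ chordSeg s(p, q') :=
      ⟨left_mem_segment ℝ p q, left_mem_segment ℝ p q'⟩
    rw [hd] at this
    exact this
  have ex : ∀ p : ℝ × ℝ, ∃ q, (∃ c ∈ A, p ∈ c) → s(p, q) ∈ A := by
    intro p
    by_cases h : ∃ c ∈ A, p ∈ c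
    · obtain ⟨c, hc, q, rfl⟩ := h
      exact ⟨q, fun _ => hc⟩
    · exact ⟨p, fun h' => absurd h' h⟩
  choose f hf using ex
  have hu : ∀ p q, s(p, q) ∈ A → q = f p := by
    intro p q h
    exact uniq p q (f p) h (hf p ⟨_, h, Sym2.mem_mk_left p q⟩)
  refine ⟨f, ?_, hu⟩
  intro p hp
  have h1 := hf p hp
  refine ⟨h1, ?_, ?_⟩
  · exact (hu _ _ (by rw [Sym2.eq_swap]; exact h1)).symm
  · obtain ⟨x, y, j, k, hjk, hx, hy, hxy, e⟩ := hA _ h1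
    rcases Sym2.eq_iff.1 e with ⟨e1, e2⟩ | ⟨e1, e2⟩
    · rw [e2]
      subst e1
      exact ⟨j, k, hjk, hx, hy⟩
    · rw [e2]
      subst e1
      exact ⟨k, j, hjk.symm, hy, hx⟩

theorem main_ccw (n : ℕ) [NeZero n] (hn : 3 ≤ n) (v : Fin n → ℝ × ℝ)
    (hinj : Function.Injective v) (hv : CCW v)
    (A B : Finset (Sym2 (ℝ × ℝ)))
    (hA : ∀ c ∈ A, ∃ p q : ℝ × ℝ, ∃ j k : Fin n, j ≠ k ∧
      IntSide v j p ∧ IntSide v k q ∧ p ≠ q ∧ c = s(p, q))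
    (hB : ∀ c ∈ B, ∃ p q : ℝ × ℝ, ∃ j k : Fin n, j ≠ k ∧
      IntSide v j p ∧ IntSide v k q ∧ p ≠ q ∧ c = s(p, q))
    (hAdisj : ∀ c ∈ A, ∀ c' ∈ A, c ≠ c' → chordSeg c ∩ chordSeg c' = ∅)
    (hBdisj : ∀ c ∈ B, ∀ c' ∈ B, c ≠ c' → chordSeg c ∩ chordSeg c' = ∅)
    (hends : {p : ℝ × ℝ | ∃ c ∈ A, p ∈ c} = {p : ℝ × ℝ | ∃ c ∈ B, p ∈ c}) :
    A = B ∨ ∃ p qa qb : ℝ × ℝ, s(p, qa) ∈ A ∧ s(p, qb) ∈ B ∧ p ≠ qa ∧ p ≠ qb ∧ qa ≠ qb ∧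
      (∃ j : Fin n, p ∈ segment ℝ (v j) (v (j + 1))) ∧
      0 < det2 (qb - p) (qa - p) ∧
      (∃ j k : Fin n, j ≠ k ∧ IntSide v j qa ∧ IntSide v k qb) := by
  classical
  by_cases hno : ∃ p qa qb : ℝ × ℝ, s(p, qa) ∈ A ∧ s(p, qb) ∈ B ∧ p ≠ qa ∧ p ≠ qb ∧ qa ≠ qb ∧
      (∃ j : Fin n, p ∈ segment ℝ (v j) (v (j + 1))) ∧
      0 < det2 (qb - p) (qa - p) ∧
      (∃ j k : Fin n, j ≠ k ∧ IntSide v j qa ∧ IntSide v k qb)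
  · exact Or.inr hno
  left
  obtain ⟨a, ha, hau⟩ := partner hA hAdisj
  obtain ⟨b, hb, hbu⟩ := partner hB hBdisj
  -- the endpoint set
  set P : Finset (ℝ × ℝ) := A.biUnion Sym2.toFinset with hP
  have memA : ∀ p, p ∈ P ↔ ∃ c ∈ A, p ∈ c := by
    intro p
    simp [hP]
  have memB : ∀ p, p ∈ P ↔ ∃ c ∈ B, p ∈ c := by
    intro p
    rw [memA]
    exact Set.ext_iff.1 hends p
  have aP : ∀ p ∈ P, a p ∈ P := fun p hp =>
    (memA _).2 ⟨_, (ha p ((memA p).1 hp)).1, Sym2.mem_mk_right _ _⟩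
  have bP : ∀ p ∈ P, b p ∈ P := fun p hp =>
    (memB _).2 ⟨_, (hb p ((memB p).1 hp)).1, Sym2.mem_mk_right _ _⟩
  have aa : ∀ p ∈ P, a (a p) = p := fun p hp => (ha p ((memA p).1 hp)).2.1
  have bb : ∀ p ∈ P, b (b p) = p := fun p hp => (hb p ((memB p).1 hp)).2.1
  have aA : ∀ p ∈ P, s(p, a p) ∈ A := fun p hp => (ha p ((memA p).1 hp)).1
  have bB : ∀ p ∈ P, s(p, b p) ∈ B := fun p hp => (hb p ((memB p).1 hp)).1
  have hside : ∀ p : ℝ × ℝ, ∃ j : Fin n, p ∈ P → IntSide v j p := by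
    intro p
    by_cases hp : p ∈ P
    · obtain ⟨j, k, -, hj, -⟩ := (ha p ((memA p).1 hp)).2.2
      exact ⟨j, fun _ => hj⟩
    · exact ⟨0, fun h => absurd h hp⟩
  choose s hs using hside
  have sa : ∀ p ∈ P, s (a p) ≠ s p := by
    intro p hp e
    obtain ⟨j, k, hjk, hj, hk⟩ := (ha p ((memA p).1 hp)).2.2
    have e1 := side_unique hn hv hj (hs p hp)
    have e2 := side_unique hn hv hk (hs _ (aP p hp))
    exact hjk (by rw [← e1, ← e2, e])
  have sb : ∀ p ∈ P, s (b p) ≠ s p := by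
    intro p hp e
    obtain ⟨j, k, hjk, hj, hk⟩ := (hb p ((memB p).1 hp)).2.2
    have e1 := side_unique hn hv hj (hs p hp)
    have e2 := side_unique hn hv hk (hs _ (bP p hp))
    exact hjk (by rw [← e1, ← e2, e])
  have hle : ∀ p ∈ P, (s (a p) - s p).val ≤ (s (b p) - s p).val := by
    intro p hp
    by_contra hlt
    push Not at hlt
    have hpos := det_pos_of_lt hn hv (hs p hp) (hs _ (bP p hp)) (hs _ (aP p hp)) (sb p hp) hlt
    have hne : s (a p) ≠ s (b p) := fun e => by rw [e] at hlt; exact lt_irrefl _ hlt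
    exact hno ⟨p, a p, b p, aA p hp, bB p hp,
      fun e => sa p hp (congrArg s e.symm), fun e => sb p hp (congrArg s e.symm),
      fun e => hne (congrArg s e), ⟨s p, (hs p hp).1⟩, hpos,
      s (a p), s (b p), hne, hs _ (aP p hp), hs _ (bP p hp)⟩
  have hsame := same_sides P s a b aP aa sa bP bb sb hle
  -- order reversal
  have antiG : ∀ (f : ℝ × ℝ → ℝ × ℝ) (F : Finset (Sym2 (ℝ × ℝ))),
      (∀ c ∈ F, ∀ c' ∈ F, c ≠ c' → chordSeg c ∩ chordSeg c' = ∅) →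
      (∀ p ∈ P, Sym2.mk p (f p) ∈ F) → (∀ p ∈ P, f p ∈ P) →
      (∀ p ∈ P, s (f p) ≠ s p) →
      ∀ p ∈ P, ∀ p' ∈ P, s p = s p' → s (f p) = s (f p') →
        pos v (s p) p < pos v (s p) p' → pos v (s (f p)) (f p') ≤ pos v (s (f p)) (f p) := by
    intro f F hF fF fP sf p hp p' hp' h1 h2 h
    refine anti hn hv (sf p hp).symm (hs p hp) (h1 ▸ hs p' hp') (hs _ (fP p hp))
      (h2 ▸ hs _ (fP p' hp')) ?_ h
    refine hF _ (fF p hp) _ (fF p' hp') ?_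
    intro e
    rcases Sym2.eq_iff.1 e with ⟨e1, _⟩ | ⟨e1, _⟩
    · rw [← e1] at h; exact lt_irrefl _ h
    · apply sf p' hp'
      rw [← e1, h1]
  have antiA := antiG a A hAdisj aA aP sa
  have antiB := antiG b B hBdisj bB bP sb
  have hab : ∀ p ∈ P, a p = b p := by
    by_contra hcon
    push Not at hcon
    obtain ⟨p0, hp0, hne0⟩ := hcon
    obtain ⟨p, hpm, hmin⟩ := Finset.exists_min_image
      (P.filter (fun p => a p ≠ b p ∧ s p = s p0 ∧ s (a p) = s (a p0)))
      (fun p => pos v (s p0) p) ⟨p0, by simp [hp0, hne0]⟩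
    rw [Finset.mem_filter] at hpm
    obtain ⟨hp, hne, h1, h2⟩ := hpm
    have apS := hs _ (aP p hp)
    have bpS := hs _ (bP p hp)
    rw [← hsame p hp] at bpS
    -- a generic contradiction
    have gen : ∀ p'' ∈ P, s p'' = s p → s (a p'') = s (a p) → a p'' ≠ b p'' →
        pos v (s p) p ≤ pos v (s p) p'' := by
      intro x hx e1 e2 e3
      have := hmin x (Finset.mem_filter.2 ⟨hx, e3, e1.trans h1, e2.trans h2⟩)
      rw [h1]; exact this
    rcases lt_trichotomy (pos v (s (a p)) (a p)) (pos v (s (a p)) (b p)) with hlt | heq | hlt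
    · -- x = a (b p)
      set x := a (b p) with hx
      have xP : x ∈ P := aP _ (bP p hp)
      have ax : a x = b p := aa _ (bP p hp)
      have sx : s x = s p := by
        rw [hx, hsame _ (bP p hp), bb p hp]
      have sax : s (a x) = s (a p) := by rw [ax, hsame p hp]
      have hxp : x ≠ p := fun e => hne (by rw [← ax, e])
      have nx : a x ≠ b x := by
        intro e
        apply hxp
        rw [← bb x xP, ← e, ax, bb p hp]
      have hge := gen x xP sx sax nx
      rcases hge.lt_or_eq with hge | hge
      · have := antiA p hp x xP sx.symm sax.symm hge
        rw [ax] at this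
        linarith
      · exact hxp (pos_inj hn hinj (hs p hp) (sx ▸ hs x xP) hge).symm
    · exact hne (pos_inj hn hinj apS bpS heq)
    · set x := b (a p) with hx
      have xP : x ∈ P := bP _ (aP p hp)
      have bx : b x = a p := bb _ (aP p hp)
      have sx : s x = s p := by
        rw [hx, ← hsame _ (aP p hp), aa p hp]
      have sax : s (a x) = s (a p) := by rw [hsame x xP, bx]
      have hxp : x ≠ p := fun e => hne (by rw [← bx, e])
      have nx : a x ≠ b x := by
        intro e
        apply hxp
        rw [← aa x xP, e, bx, aa p hp]
      have hge := gen x xP sx sax nx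
      rcases hge.lt_or_eq with hge | hge
      · have := antiB p hp x xP sx.symm (by rw [bx, hsame p hp]) hge
        rw [bx, ← hsame p hp] at this
        linarith
      · exact hxp (pos_inj hn hinj (hs p hp) (sx ▸ hs x xP) hge).symm
  ext c
  induction c using Sym2.ind with
  | _ x y =>
    constructor
    · intro h
      have hx : x ∈ P := (memA x).2 ⟨_, h, Sym2.mem_mk_left _ _⟩
      rw [hau x y h, hab x hx]
      exact bB x hx
    · intro h
      have hx : x ∈ P := (memB x).2 ⟨_, h, Sym2.mem_mk_left _ _⟩
      rw [hbu x y h, ← hab x hx]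
      exact aA x hx

theorem intSide_neg {n : ℕ} [NeZero n] (v : Fin n → ℝ × ℝ) (j : Fin n) (p : ℝ × ℝ) :
    IntSide (fun i => v (-i)) (-(j + 1)) p ↔ IntSide v j p := by
  unfold IntSide
  have e : -(-(j + 1) + 1) = j := by abel
  simp only [e, neg_neg]
  rw [segment_symm]
  tauto

theorem ccw_neg {n : ℕ} [NeZero n] {v : Fin n → ℝ × ℝ}
    (h : ∀ j k : Fin n, k ≠ j → k ≠ j + 1 → det2 (v (j + 1) - v j) (v k - v j) < 0) :
    CCW (fun i => v (-i)) := by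
  intro j k h1 h2
  have := h (-(j + 1)) (-k) (fun e => h2 (neg_injective e)) (by
    intro e
    apply h1
    apply neg_injective
    rw [e]; abel)
  rw [show -(j + 1) + 1 = -j by abel] at this
  simp only [det2, Prod.fst_sub, Prod.snd_sub] at this ⊢
  linarith

theorem main_any (n : ℕ) [NeZero n] (hn : 3 ≤ n) (v : Fin n → ℝ × ℝ)
    (hinj : Function.Injective v)
    (hcyc : (∀ j k : Fin n, k ≠ j → k ≠ j + 1 →
        0 < det2 (v (j + 1) - v j) (v k - v j)) ∨
      (∀ j k : Fin n, k ≠ j → k ≠ j + 1 →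
        det2 (v (j + 1) - v j) (v k - v j) < 0))
    (A B : Finset (Sym2 (ℝ × ℝ)))
    (hA : ∀ c ∈ A, ∃ p q : ℝ × ℝ, ∃ j k : Fin n, j ≠ k ∧
      IntSide v j p ∧ IntSide v k q ∧ p ≠ q ∧ c = s(p, q))
    (hB : ∀ c ∈ B, ∃ p q : ℝ × ℝ, ∃ j k : Fin n, j ≠ k ∧
      IntSide v j p ∧ IntSide v k q ∧ p ≠ q ∧ c = s(p, q))
    (hAdisj : ∀ c ∈ A, ∀ c' ∈ A, c ≠ c' → chordSeg c ∩ chordSeg c' = ∅)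
    (hBdisj : ∀ c ∈ B, ∀ c' ∈ B, c ≠ c' → chordSeg c ∩ chordSeg c' = ∅)
    (hends : {p : ℝ × ℝ | ∃ c ∈ A, p ∈ c} = {p : ℝ × ℝ | ∃ c ∈ B, p ∈ c}) :
    A = B ∨ ∃ p qa qb : ℝ × ℝ, s(p, qa) ∈ A ∧ s(p, qb) ∈ B ∧ p ≠ qa ∧ p ≠ qb ∧ qa ≠ qb ∧
      (∃ j : Fin n, p ∈ segment ℝ (v j) (v (j + 1))) ∧
      0 < det2 (qb - p) (qa - p) ∧
      (∃ j k : Fin n, j ≠ k ∧ IntSide v j qa ∧ IntSide v k qb) := by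
  rcases hcyc with h | h
  · exact main_ccw n hn v hinj h A B hA hB hAdisj hBdisj hends
  · have tr : ∀ F : Finset (Sym2 (ℝ × ℝ)),
        (∀ c ∈ F, ∃ p q : ℝ × ℝ, ∃ j k : Fin n, j ≠ k ∧
          IntSide v j p ∧ IntSide v k q ∧ p ≠ q ∧ c = s(p, q)) →
        (∀ c ∈ F, ∃ p q : ℝ × ℝ, ∃ j k : Fin n, j ≠ k ∧
          IntSide (fun i => v (-i)) j p ∧ IntSide (fun i => v (-i)) k q ∧
            p ≠ q ∧ c = s(p, q)) := by
      intro F hF c hc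
      obtain ⟨p, q, j, k, hjk, hj, hk, r⟩ := hF c hc
      exact ⟨p, q, -(j + 1), -(k + 1), by simpa using hjk, (intSide_neg v j p).2 hj,
        (intSide_neg v k q).2 hk, r⟩
    have back : ∀ (j : Fin n) (p : ℝ × ℝ), IntSide (fun i => v (-i)) j p →
        IntSide v (-(j + 1)) p := by
      intro j p hj
      apply (intSide_neg v (-(j + 1)) p).1
      rwa [show -(-(j + 1) + 1) = j by abel]
    rcases main_ccw n hn (fun i => v (-i)) (hinj.comp neg_injective) (ccw_neg h) A B
      (tr A hA) (tr B hB) hAdisj hBdisj hends with e | ⟨p, qa, qb, h1, h2, h3, h4, h5,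
        ⟨i, hi⟩, h7, j, k, hjk, hj, hk⟩
    · exact Or.inl e
    · refine Or.inr ⟨p, qa, qb, h1, h2, h3, h4, h5, ⟨-(i + 1), ?_⟩, h7,
        -(j + 1), -(k + 1), by simpa using hjk, back _ _ hj, back _ _ hk⟩
      rw [show -(i + 1) + 1 = -i by abel, segment_symm]
      exact hi

end ChordExchange

/-- the polygon version of the chord-exchange lemma.  The
vertices `v 0, …, v (n-1)` of the `n`-gon are pairwise distinct, no three of
them are collinear, each is an extreme point of their convex hull, and they are
listed in cyclic order (all remaining vertices lie on one and the same side of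
each directed side, either always the left or always the right). -/
theorem stmt2 (n : ℕ) [NeZero n] (hn : 3 ≤ n) (v : Fin n → ℝ × ℝ)
    (hinj : Function.Injective v)
    (hextreme : ∀ j : Fin n,
      v j ∈ Set.extremePoints ℝ (convexHull ℝ (Set.range v)))
    (hcoll : ∀ j k l : Fin n, j ≠ k → k ≠ l → j ≠ l →
      ¬ Collinear ℝ ({v j, v k, v l} : Set (ℝ × ℝ)))
    (hcyc : (∀ j k : Fin n, k ≠ j → k ≠ j + 1 →
        0 < det2 (v (j + 1) - v j) (v k - v j)) ∨
      (∀ j k : Fin n, k ≠ j → k ≠ j + 1 →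
        det2 (v (j + 1) - v j) (v k - v j) < 0))
    (A B : Finset (Sym2 (ℝ × ℝ)))
    (hA : ∀ c ∈ A, ∃ p q : ℝ × ℝ, ∃ j k : Fin n, j ≠ k ∧
      IntSide v j p ∧ IntSide v k q ∧ p ≠ q ∧ c = s(p, q))
    (hB : ∀ c ∈ B, ∃ p q : ℝ × ℝ, ∃ j k : Fin n, j ≠ k ∧
      IntSide v j p ∧ IntSide v k q ∧ p ≠ q ∧ c = s(p, q))
    (hAdisj : ∀ c ∈ A, ∀ c' ∈ A, c ≠ c' → chordSeg c ∩ chordSeg c' = ∅)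
    (hBdisj : ∀ c ∈ B, ∀ c' ∈ B, c ≠ c' → chordSeg c ∩ chordSeg c' = ∅)
    (hends : {p : ℝ × ℝ | ∃ c ∈ A, p ∈ c} = {p : ℝ × ℝ | ∃ c ∈ B, p ∈ c}) :
    A = B ∨
      ∃ a₁ ∈ A, ∃ b₁ ∈ B, ∃ a₂ ∈ A, ∃ b₂ ∈ B,
        ∃ p₁ p₂ qa₁ qb₁ qa₂ qb₂ : ℝ × ℝ,
          (∃ j : Fin n, p₁ ∈ segment ℝ (v j) (v (j + 1))) ∧
          (∃ j : Fin n, p₂ ∈ segment ℝ (v j) (v (j + 1))) ∧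
          a₁ = s(p₁, qa₁) ∧ b₁ = s(p₁, qb₁) ∧ p₁ ≠ qa₁ ∧ p₁ ≠ qb₁ ∧
            qa₁ ≠ qb₁ ∧ 0 < det2 (qb₁ - p₁) (qa₁ - p₁) ∧
            (∃ j k : Fin n, j ≠ k ∧ IntSide v j qa₁ ∧ IntSide v k qb₁) ∧
          a₂ = s(p₂, qa₂) ∧ b₂ = s(p₂, qb₂) ∧ p₂ ≠ qa₂ ∧ p₂ ≠ qb₂ ∧
            qa₂ ≠ qb₂ ∧ det2 (qb₂ - p₂) (qa₂ - p₂) < 0 ∧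
            (∃ j k : Fin n, j ≠ k ∧ IntSide v j qa₂ ∧ IntSide v k qb₂) := by
  by_cases hAB : A = B
  · exact Or.inl hAB
  right
  rcases main_any n hn v hinj hcyc A B hA hB hAdisj hBdisj hends with
    e | ⟨p, qa, qb, h1, h2, h3, h4, h5, h6, h7, h8⟩
  · exact absurd e hAB
  rcases main_any n hn v hinj hcyc B A hB hA hBdisj hAdisj hends.symm with
    e | ⟨p', qb', qa', g1, g2, g3, g4, g5, g6, g7, j, k, hjk, hj, hk⟩
  · exact absurd e.symm hAB
  refine ⟨_, h1, _, h2, _, g2, _, g1, p, p', qa, qb, qa', qb', h6, g6, rfl, rfl, h3, h4, h5, h7,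
    h8, rfl, rfl, g4, g3, g5.symm, ?_, k, j, hjk.symm, hk, hj⟩
  simp only [det2] at g7 ⊢
  linarith
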